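/- Let x ∈ V(n,k), suppose l ∈ x and l < m ≤ n with x ∩ [l,m] = {l}, and set x′ = (x \ {l}) ∪ {m}. Then there exists a path γ in Γ(n,k) from x to x′ whose edges are labelled R_{l+1}, R_{l+2}, …, R_m in order, and γ is the unique path in Γ(n,k) from x to x′ with this sequence of labels. -/

import Mathlib

/-- `x` is an I-state in `V(n,k)`: a subset of `{0,…,n}` with `k` elements. -/
def Istate (n k : ℕ) (x : Finset ℕ) : Prop :=
  x ⊆ Finset.range (n + 1) ∧ x.card = k

/-- Minimal relative weight vector `v_i(x,y) = |y ∩ [i,n]| − |x ∩ [i,n]|`. -/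
def vwt (n : ℕ) (x y : Finset ℕ) (i : ℕ) : ℤ :=
  ((y ∩ Finset.Icc i n).card : ℤ) - ((x ∩ Finset.Icc i n).card : ℤ)

/-- Minimal relative grading vector `|v|_i(x,y) = |v_i(x,y)|`. -/
def avwt (n : ℕ) (x y : Finset ℕ) (i : ℕ) : ℤ := |vwt n x y i|

/-- Edge labels of the quiver `Γ(n,k,𝒮)`. -/
inductive Lab : Type
  | R : ℕ → Lab
  | L : ℕ → Lab
  | U : ℕ → Lab
  | C : ℕ → Lab
deriving DecidableEq

/-- The target vertex of the edge with label `l` starting at `x`. -/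
def step (x : Finset ℕ) : Lab → Finset ℕ
  | .R i => insert i (x.erase (i - 1))
  | .L i => insert (i - 1) (x.erase i)
  | .U _ => x
  | .C _ => x

/-- Whether the edge with label `l` exists at the vertex `x` in `Γ(n,k,S)`
(for `Γ(n,k)` take `S = ∅`). -/
def validEdge (n : ℕ) (S : Set ℕ) (x : Finset ℕ) : Lab → Prop
  | .R i => 1 ≤ i ∧ i ≤ n ∧ (i - 1) ∈ x ∧ i ∉ x
  | .L i => 1 ≤ i ∧ i ≤ n ∧ i ∈ x ∧ (i - 1) ∉ x
  | .U i => 1 ≤ i ∧ i ≤ n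
  | .C i => i ∈ S

/-- Whether the list of labels `ls` describes a path of `Γ(n,k,S)` starting at `x`.
A path is recorded as its start vertex together with the list of labels of its edges
(the intermediate vertices are then determined). -/
def validPath (n : ℕ) (S : Set ℕ) : Finset ℕ → List Lab → Prop
  | _, [] => True
  | x, l :: ls => validEdge n S x l ∧ validPath n S (step x l) ls

/-- The end vertex of the path starting at `x` with labels `ls`. -/
def endpt : Finset ℕ → List Lab → Finset ℕ
  | x, [] => x
  | x, l :: ls => endpt (step x l) ls

/-- Moving an element `l` of `x` to the right through `d` unoccupied positions is a path. -/
theorem validPath_and_endpt_range'_R {n : ℕ} (S : Set ℕ) (d : ℕ) {l : ℕ} {x : Finset ℕ}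
    (hl : l ∈ x) (hd : l + d ≤ n) (hfree : ∀ j, l < j → j ≤ l + d → j ∉ x) :
    validPath n S x ((List.range' (l + 1) d).map Lab.R) ∧
      endpt x ((List.range' (l + 1) d).map Lab.R) = insert (l + d) (x.erase l) := by
  induction d generalizing l x with
  | zero => simp [validPath, endpt, Finset.insert_erase hl]
  | succ d ih =>
    have hnot : l + 1 ∉ x := hfree _ (by lia) (by lia)
    obtain ⟨hv, he⟩ := ih (l := l + 1) (x := insert (l + 1) (x.erase l))
      (Finset.mem_insert_self _ _) (by lia) fun j h₁ h₂ => by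
        have := hfree j (by lia) (by lia)
        simp only [Finset.mem_insert, Finset.mem_erase]
        lia
    rw [Finset.erase_insert (by simp [hnot])] at he
    simp only [List.range'_succ, List.map_cons, validPath, endpt, validEdge, step,
      Nat.add_sub_cancel]
    exact ⟨⟨⟨by lia, by lia, hl, hnot⟩, hv⟩, by rw [he]; congr 1; lia⟩

/-- If `l ∈ x`, `l < m ≤ n`, and `x ∩ [l,m] = {l}`, then the list of labels
`R_{l+1}, R_{l+2}, …, R_m` describes a path in `Γ(n,k)` from `x` to
`x′ = (x \ {l}) ∪ {m}` (in our encoding a path is determined by its start vertex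
and its label sequence, so this path is automatically the unique one from `x`
to `x′` with this sequence of labels). -/
theorem stmt2 (n k : ℕ) (hn : 1 ≤ n) (x : Finset ℕ) (hx : Istate n k x)
    (l m : ℕ) (hl : l ∈ x) (hlm : l < m) (hm : m ≤ n)
    (hcap : x ∩ Finset.Icc l m = {l}) :
    validPath n ∅ x ((List.range' (l + 1) (m - l)).map Lab.R) ∧
      endpt x ((List.range' (l + 1) (m - l)).map Lab.R) = insert m (x.erase l) := by
  have hfree : ∀ j, l < j → j ≤ l + (m - l) → j ∉ x := fun j h₁ h₂ hj => by
    have : j ∈ x ∩ Finset.Icc l m := by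
      simp only [Finset.mem_inter, Finset.mem_Icc]
      exact ⟨hj, by lia, by lia⟩
    rw [hcap, Finset.mem_singleton] at this
    lia
  simpa [Nat.add_sub_cancel' hlm.le] using
    validPath_and_endpt_range'_R ∅ (m - l) hl (by lia : l + (m - l) ≤ n) hfree
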